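/- arXiv:2402.06364 — 2 statements merged into one kernel-verified Lean document; each statement's English description precedes it below -/
import Mathlib

section
/- Asymptotic expansion of L_α: Let α ∈ (0,1) ∪ (1,2) and define m*(ξ) := L_α(ξ) − V_α + A_α·ξ^{α−1} for ξ ≥ 1/2. Then m* is infinitely differentiable on [1/2, ∞), and for every β ∈ ℕ there exists a constant C_β > 0 such that |d^β/dξ^β m*(ξ)| ≤ C_β · ξ^{α−3−β} for all ξ ≥ 1/2. In other words, L_α(ξ) = V_α − A_α|ξ|^{α−1} + m*(ξ) with m* a Fourier multiplier of order α−3. -/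
/-- The constant `c_α = Γ(α/2)/(2^{1-α} Γ(1-α/2))`. -/
noncomputable def cc (α : ℝ) : ℝ :=
  Real.Gamma (α / 2) / (2 ^ (1 - α) * Real.Gamma (1 - α / 2))

/-- The constant `V_α`. -/
noncomputable def VV (α : ℝ) : ℝ :=
  cc α / (2 * (1 - α / 2)) * (1 / (1 - α)) *
    (Real.Gamma (2 - α) / (Real.Gamma (1 - α / 2)) ^ 2)

/-- The constant `A_α`. -/
noncomputable def AA (α : ℝ) : ℝ :=
  cc α / (2 * (1 - α / 2)) * (1 / (1 - α)) *
    (Real.Gamma (3 - α) / (Real.Gamma (1 - α / 2) * Real.Gamma (α / 2)))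

/-- The symbol `L_α(ξ) = V_α - A_α Γ(α/2+|ξ|)/Γ(1-α/2+|ξ|)`. -/
noncomputable def LL (α ξ : ℝ) : ℝ :=
  VV α - AA α * (Real.Gamma (α / 2 + |ξ|) / Real.Gamma (1 - α / 2 + |ξ|))

/-- The remainder `m*(ξ) = L_α(ξ) - V_α + A_α ξ^(α-1)` in the asymptotic expansion of `L_α`. -/
noncomputable def mStar (α ξ : ℝ) : ℝ := LL α ξ - VV α + AA α * ξ ^ (α - 1)

open Filter Topology

noncomputable def Ff (a : ℝ) (w : ℂ) : ℂ :=
  (1 + (1 - (a:ℂ)) * w) / (1 + (a:ℂ) * w) * (1 + w) ^ ((2 * a - 1 : ℝ) : ℂ)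

noncomputable def hh (a : ℝ) (z : ℂ) : ℂ :=
  Complex.Gamma (a + z) / Complex.Gamma (1 - a + z) * z ^ ((1 - 2 * a : ℝ) : ℂ)

lemma one_le_norm_aux (t : ℝ) (ht : 0 ≤ t) (w : ℂ) (hw : 0 ≤ w.re) : 1 ≤ ‖1 + (t:ℂ) * w‖ := by
  refine le_trans ?_ (Complex.re_le_norm _)
  simp
  positivity

lemma ne_zero_of_one_le_norm {w : ℂ} (h : 1 ≤ ‖w‖) : w ≠ 0 := by
  rintro rfl
  simp at h
  linarith

lemma Ff_deriv (a : ℝ) (h0 : 0 < a) (w : ℂ) (hw : 0 ≤ w.re) :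
    HasDerivAt (Ff a) (((2 * a - 1) * a * (1 - a) : ℝ) * w ^ 2 * (1 + w) ^ ((2 * a - 2 : ℝ) : ℂ)
      / (1 + (a:ℂ) * w) ^ 2) w := by
  have n1 : 1 + (a:ℂ) * w ≠ 0 := ne_zero_of_one_le_norm (one_le_norm_aux a h0.le w hw)
  have n2 : 1 + w ≠ 0 := by
    have := one_le_norm_aux 1 zero_le_one w hw
    simpa using ne_zero_of_one_le_norm this
  have sl : 1 + w ∈ Complex.slitPlane := by
    left; simp; linarith
  have d1 : HasDerivAt (fun w : ℂ => 1 + (1 - (a:ℂ)) * w) (1 - (a:ℂ)) w := by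
    simpa using ((hasDerivAt_id w).const_mul (1 - (a:ℂ))).const_add 1
  have d2 : HasDerivAt (fun w : ℂ => 1 + (a:ℂ) * w) (a:ℂ) w := by
    simpa using ((hasDerivAt_id w).const_mul (a:ℂ)).const_add 1
  have d3 : HasDerivAt (fun w : ℂ => 1 + w) 1 w := (hasDerivAt_id w).const_add 1
  have d4 := d3.cpow_const (c := ((2 * a - 1 : ℝ) : ℂ)) sl
  refine ((d1.div d2 n1).mul d4).congr_deriv ?_
  have e1 : (1 + w) ^ ((2 * a - 1 : ℝ) : ℂ) = (1 + w) ^ ((2 * a - 2 : ℝ) : ℂ) * (1 + w) := by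
    rw [show ((2 * a - 1 : ℝ) : ℂ) = ((2 * a - 2 : ℝ) : ℂ) + 1 by push_cast; ring,
      Complex.cpow_add _ _ n2, Complex.cpow_one]
  have e2 : (((2 * a - 1 : ℝ) : ℂ) - 1) = ((2 * a - 2 : ℝ) : ℂ) := by push_cast; ring
  simp only [Pi.div_apply]
  rw [e2, e1]
  generalize (1 + w) ^ ((2 * a - 2 : ℝ) : ℂ) = X
  push_cast
  field_simp
  ring

lemma Ff_bound (a : ℝ) (h0 : 0 < a) (h1 : a < 1) (w : ℂ) (hw : 0 ≤ w.re) :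
    ‖Ff a w - 1‖ ≤ ‖w‖ ^ 3 := by
  have hF0 : Ff a 0 = 1 := by simp [Ff]
  set s : Set ℂ := {u : ℂ | 0 ≤ u.re} ∩ Metric.closedBall 0 ‖w‖ with hs
  have hconv : Convex ℝ s := (convex_halfSpace_re_ge 0).inter (convex_closedBall _ _)
  have key := Convex.norm_image_sub_le_of_norm_hasDerivWithin_le (f := Ff a) (s := s) (x := 0)
    (y := w) (C := ‖w‖ ^ 2)
    (fun u hu => (Ff_deriv a h0 u hu.1).hasDerivWithinAt) ?_ hconv ?_ ?_
  · rw [hF0] at key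
    simpa [pow_succ] using key
  · rintro u ⟨hu, hu2⟩
    have hu2 : ‖u‖ ≤ ‖w‖ := by simpa using hu2
    have hu : 0 ≤ u.re := hu
    have b1 := one_le_norm_aux a h0.le u hu
    have b2 : 1 ≤ ‖1 + u‖ := by simpa using one_le_norm_aux 1 zero_le_one u hu
    rw [norm_div, norm_mul, norm_mul, norm_pow, norm_pow, Complex.norm_cpow_real,
      Complex.norm_real]
    have b3 : ‖1 + u‖ ^ (2 * a - 2) ≤ 1 := Real.rpow_le_one_of_one_le_of_nonpos b2 (by linarith)
    have b3' : 0 ≤ ‖1 + u‖ ^ (2 * a - 2) := by positivity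
    have b4 : ‖(2 * a - 1) * a * (1 - a)‖ ≤ 1 := by
      rw [norm_mul, norm_mul, Real.norm_eq_abs, Real.norm_eq_abs, Real.norm_eq_abs]
      have c1 : |2 * a - 1| ≤ 1 := abs_le.2 ⟨by linarith, by linarith⟩
      have c2 : |a| ≤ 1 := abs_le.2 ⟨by linarith, by linarith⟩
      have c3 : |1 - a| ≤ 1 := abs_le.2 ⟨by linarith, by linarith⟩
      exact mul_le_one₀ (mul_le_one₀ c1 (abs_nonneg _) c2) (abs_nonneg _) c3
    have b5 : ‖u‖ ^ 2 ≤ ‖w‖ ^ 2 := by gcongr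
    rw [div_le_iff₀ (by positivity)]
    calc ‖(2 * a - 1) * a * (1 - a)‖ * ‖u‖ ^ 2 * ‖1 + u‖ ^ (2 * a - 2)
        ≤ 1 * ‖w‖ ^ 2 * 1 := by gcongr
      _ = ‖w‖ ^ 2 * 1 := by ring
      _ ≤ ‖w‖ ^ 2 * ‖1 + (a:ℂ) * u‖ ^ 2 := by
        gcongr
        exact one_le_pow₀ b1
  · simp [hs]
  · simp [hs, hw]

lemma log_aux (z : ℂ) (hz : 0 < z.re) :
    Complex.log (z + 1) = Complex.log z + Complex.log (1 + z⁻¹) := by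
  have hz0 : z ≠ 0 := by rintro rfl; simp at hz
  have hi : 0 < (1 + z⁻¹).re := by
    have : 0 < Complex.normSq z := Complex.normSq_pos.2 hz0
    simp [Complex.inv_re]
    positivity
  have hi0 : 1 + z⁻¹ ≠ 0 := by intro h; rw [h] at hi; simp at hi
  have a1 := Complex.abs_arg_lt_pi_div_two_iff.2 (Or.inl hz)
  have a2 := Complex.abs_arg_lt_pi_div_two_iff.2 (Or.inl hi)
  rw [abs_lt] at a1 a2
  rw [← Complex.log_mul hz0 hi0 ⟨by linarith, by linarith⟩]
  congr 1
  field_simp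

lemma hh_step (a : ℝ) (h0 : 0 < a) (h1 : a < 1) (z : ℂ) (hz : 0 < z.re) :
    hh a z = hh a (z + 1) * Ff a z⁻¹ := by
  have hz0 : z ≠ 0 := by rintro rfl; simp at hz
  have n1 : (a:ℂ) + z ≠ 0 := by
    intro h; have := congrArg Complex.re h; simp at this; linarith
  have n2 : 1 - (a:ℂ) + z ≠ 0 := by
    intro h; have := congrArg Complex.re h; simp at this; linarith
  have n3 : z + 1 ≠ 0 := by
    intro h; have := congrArg Complex.re h; simp at this; linarith
  have n4 : 1 + z⁻¹ ≠ 0 := by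
    intro h; apply n3; field_simp at h; simpa using h
  have g2 : Complex.Gamma (1 - a + z) ≠ 0 := Complex.Gamma_ne_zero_of_re_pos (by simp; linarith)
  have hpow : (z + 1) ^ ((1 - 2 * a : ℝ) : ℂ) * (1 + z⁻¹) ^ ((2 * a - 1 : ℝ) : ℂ)
      = z ^ ((1 - 2 * a : ℝ) : ℂ) := by
    rw [Complex.cpow_def_of_ne_zero n3, Complex.cpow_def_of_ne_zero n4,
      Complex.cpow_def_of_ne_zero hz0, ← Complex.exp_add, log_aux z hz]
    congr 1
    push_cast
    ring
  unfold hh Ff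
  rw [← add_assoc, ← add_assoc, Complex.Gamma_add_one _ n1, Complex.Gamma_add_one _ n2, ← hpow]
  have e : (1 + (1 - (a:ℂ)) * z⁻¹) / (1 + (a:ℂ) * z⁻¹) = (1 - a + z) / (a + z) := by
    have : 1 + (a:ℂ) * z⁻¹ ≠ 0 := by
      intro h; apply n1; field_simp at h; rw [add_comm]; simpa using h
    rw [div_eq_div_iff this n1]
    field_simp
    ring
  rw [e]
  field_simp

lemma hh_iter (a : ℝ) (h0 : 0 < a) (h1 : a < 1) (z : ℂ) (hz : 0 < z.re) (N : ℕ) :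
    hh a z = hh a (z + N) * ∏ k ∈ Finset.range N, Ff a (z + k)⁻¹ := by
  induction N with
  | zero => simp
  | succ n ih =>
    rw [ih, Finset.prod_range_succ, hh_step a h0 h1 (z + n) (by simp; positivity)]
    push_cast
    rw [← add_assoc]
    ring

lemma Gamma_shift (s : ℂ) (hs : 0 < s.re) (N : ℕ) :
    Complex.Gamma (s + N) = Complex.Gamma s * ∏ j ∈ Finset.range N, (s + j) := by
  induction N with
  | zero => simp
  | succ n ih =>
    have : s + n ≠ 0 := by
      intro h
      have := congrArg Complex.re h
      simp at this
      have : (0:ℝ) ≤ n := by positivity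
      linarith
    push_cast
    rw [← add_assoc, Complex.Gamma_add_one _ this, ih, Finset.prod_range_succ]
    ring

lemma Gamma_lim (s : ℂ) (hs : 0 < s.re) :
    Tendsto (fun n : ℕ => (n:ℂ) ^ s * n.factorial / Complex.Gamma (s + (n + 1 : ℕ)))
      atTop (𝓝 1) := by
  have hg := Complex.Gamma_ne_zero_of_re_pos hs
  have := (Complex.GammaSeq_tendsto_Gamma s).div_const (Complex.Gamma s)
  rw [div_self hg] at this
  refine this.congr fun n => ?_
  rw [Gamma_shift s hs, Complex.GammaSeq, div_div, mul_comm (Complex.Gamma s)]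

lemma hh_lim (a : ℝ) (h0 : 0 < a) (h1 : a < 1) (z : ℂ) (hz : 0 < z.re) :
    Tendsto (fun n : ℕ => hh a (z + n)) atTop (𝓝 1) := by
  rw [← tendsto_add_atTop_iff_nat 1]
  have hs : 0 < ((a:ℂ) + z).re := by simp; linarith
  have ht : 0 < (1 - (a:ℂ) + z).re := by simp; linarith
  have l1 := (Gamma_lim _ ht).div (Gamma_lim _ hs) one_ne_zero
  have l2 : Tendsto (fun n : ℕ => (1 + (z + 1) / (n:ℂ)) ^ ((1 - 2 * a : ℝ) : ℂ)) atTop (𝓝 1) := by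
    have i1 : Tendsto (fun n : ℕ => 1 + (z + 1) / (n:ℂ)) atTop (𝓝 (1 + 0)) := by
      refine tendsto_const_nhds.add ?_
      exact tendsto_const_div_atTop_nhds_zero_nat (z + 1)
    rw [add_zero] at i1
    have c : ContinuousAt (fun w : ℂ => w ^ ((1 - 2 * a : ℝ) : ℂ)) 1 :=
      (hasDerivAt_id (1:ℂ)).cpow_const (c := ((1 - 2 * a : ℝ) : ℂ)) (by simp) |>.continuousAt
    have := c.tendsto.comp i1
    simpa [Function.comp_def] using this
  have l3 := l1.mul l2
  simp only [div_one, mul_one] at l3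
  refine l3.congr' ?_
  filter_upwards [eventually_gt_atTop 0] with n hn
  have hn' : (n:ℂ) ≠ 0 := by exact_mod_cast hn.ne'
  have hnR : (0:ℝ) < n := by exact_mod_cast hn
  have hzn : z + ((n + 1 : ℕ) : ℂ) ≠ 0 := by
    intro h; have := congrArg Complex.re h; simp at this; linarith
  have hw : 1 + (z + 1) / (n:ℂ) ≠ 0 := by
    intro h; apply hzn; field_simp at h; push_cast; linear_combination h
  have e1 : (z + ((n + 1 : ℕ) : ℂ)) ^ ((1 - 2 * a : ℝ) : ℂ)
      = (n:ℂ) ^ ((1 - 2 * a : ℝ) : ℂ) * (1 + (z + 1) / (n:ℂ)) ^ ((1 - 2 * a : ℝ) : ℂ) := by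
    have : z + ((n + 1 : ℕ) : ℂ) = ((n:ℝ):ℂ) * (1 + (z + 1) / (n:ℂ)) := by
      push_cast; field_simp; ring
    rw [Complex.cpow_def_of_ne_zero hzn, Complex.cpow_def_of_ne_zero hn',
      Complex.cpow_def_of_ne_zero hw, this, Complex.log_ofReal_mul hnR hw, ← Complex.exp_add,
      Complex.ofReal_log hnR.le, Complex.ofReal_natCast]
    congr 1
    ring
  have e2 : (n:ℂ) ^ (1 - (a:ℂ) + z) = (n:ℂ) ^ ((a:ℂ) + z) * (n:ℂ) ^ ((1 - 2 * a : ℝ) : ℂ) := by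
    rw [← Complex.cpow_add _ _ hn']
    congr 1
    push_cast
    ring
  unfold hh
  simp only [Pi.div_apply]
  rw [e1, e2, ← add_assoc, ← add_assoc]
  have p1 : (n:ℂ) ^ ((a:ℂ) + z) ≠ 0 := by simp [Complex.cpow_eq_zero_iff, hn']
  have p2 : (n.factorial : ℂ) ≠ 0 := by exact_mod_cast n.factorial_ne_zero
  have g1 : Complex.Gamma (a + z + (n + 1 : ℕ)) ≠ 0 :=
    Complex.Gamma_ne_zero_of_re_pos (by simp; linarith)
  have g2 : Complex.Gamma (1 - a + z + (n + 1 : ℕ)) ≠ 0 :=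
    Complex.Gamma_ne_zero_of_re_pos (by simp; linarith)
  field_simp

lemma sum_aux (r : ℝ) (hr : 1 / 4 ≤ r) (N : ℕ) :
    ∑ k ∈ Finset.range N, 1 / (r + k) ^ 3 ≤ 5 / r ^ 2 - 5 / (r + N) ^ 2 := by
  induction N with
  | zero => simp
  | succ n ih =>
    rw [Finset.sum_range_succ]
    have hx : 1 / 4 ≤ r + n := by have : (0:ℝ) ≤ n := by positivity
                                  linarith
    push_cast
    rw [← add_assoc]
    generalize r + (n:ℝ) = x at *
    have : 1 / x ^ 3 ≤ 5 / x ^ 2 - 5 / (x + 1) ^ 2 := by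
      have hx0 : 0 < x := by linarith
      have : 5 / x ^ 2 - 5 / (x + 1) ^ 2 - 1 / x ^ 3 =
          (9 * x ^ 2 + 3 * x - 1) / (x ^ 3 * (x + 1) ^ 2) := by
        field_simp
        ring
      have : 0 ≤ (9 * x ^ 2 + 3 * x - 1) / (x ^ 3 * (x + 1) ^ 2) := by
        apply div_nonneg _ (by positivity)
        nlinarith
      linarith
    linarith

lemma norm_shift (z : ℂ) (hz : 0 < z.re) (k : ℕ) : (‖z‖ + k) / 2 ≤ ‖z + k‖ := by
  have h1 : ‖z‖ ≤ ‖z + k‖ := by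
    rw [Complex.norm_def, Complex.norm_def]
    apply Real.sqrt_le_sqrt
    simp [Complex.normSq_apply]
    have : (0:ℝ) ≤ k := by positivity
    nlinarith
  have h2 : (k:ℝ) ≤ ‖z + k‖ := by
    refine le_trans ?_ (Complex.re_le_norm _)
    simp
    exact hz.le
  linarith

lemma hh_bound (a : ℝ) (h0 : 0 < a) (h1 : a < 1) (z : ℂ) (hz : 1 / 4 ≤ z.re) :
    ‖hh a z - 1‖ ≤ 40 * Real.exp 640 / ‖z‖ ^ 2 := by
  have hz' : 0 < z.re := by linarith
  have hr : 1 / 4 ≤ ‖z‖ := hz.trans (Complex.re_le_norm _)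
  have hr0 : 0 < ‖z‖ := by linarith
  have lim : Tendsto (fun N : ℕ => ∏ k ∈ Finset.range N, Ff a (z + k)⁻¹) atTop (𝓝 (hh a z)) := by
    have l := hh_lim a h0 h1 z hz'
    have l2 := (tendsto_const_nhds (x := hh a z)).div l one_ne_zero
    rw [div_one] at l2
    refine l2.congr' ?_
    filter_upwards [l.eventually_ne one_ne_zero] with N hN
    simp only [Pi.div_apply]
    rw [div_eq_iff hN, hh_iter a h0 h1 z hz' N]
    ring
  refine le_of_tendsto ((lim.sub_const 1).norm) (Eventually.of_forall fun N => ?_)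
  have b := Finset.norm_prod_one_add_sub_one_le (Finset.range N)
    (fun k : ℕ => Ff a (z + k)⁻¹ - 1)
  simp only [add_sub_cancel] at b
  have S : ∑ k ∈ Finset.range N, ‖Ff a (z + k)⁻¹ - 1‖ ≤ 40 / ‖z‖ ^ 2 := by
    calc ∑ k ∈ Finset.range N, ‖Ff a (z + k)⁻¹ - 1‖
        ≤ ∑ k ∈ Finset.range N, 8 * (1 / (‖z‖ + k) ^ 3) := by
          apply Finset.sum_le_sum
          intro k _
          have hk : 0 ≤ ((z + k)⁻¹).re := by
            rw [Complex.inv_re]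
            apply div_nonneg _ (Complex.normSq_nonneg _)
            simp
            positivity
          refine (Ff_bound a h0 h1 _ hk).trans ?_
          rw [norm_inv]
          have q := norm_shift z hz' k
          have : ‖z + k‖⁻¹ ≤ ((‖z‖ + k) / 2)⁻¹ := by gcongr
          calc ‖z + k‖⁻¹ ^ 3 ≤ ((‖z‖ + k) / 2)⁻¹ ^ 3 := by gcongr
            _ = 8 * (1 / (‖z‖ + k) ^ 3) := by field_simp; norm_num
      _ = 8 * ∑ k ∈ Finset.range N, 1 / (‖z‖ + k) ^ 3 := by rw [Finset.mul_sum]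
      _ ≤ 8 * (5 / ‖z‖ ^ 2) := by
          have := sum_aux ‖z‖ hr N
          have p : 0 ≤ 5 / (‖z‖ + N) ^ 2 := by positivity
          linarith
      _ = 40 / ‖z‖ ^ 2 := by ring
  refine b.trans ?_
  set T := 40 / ‖z‖ ^ 2 with hT
  have hT0 : 0 ≤ T := by positivity
  have hT1 : T ≤ 640 := by
    rw [hT, div_le_iff₀ (by positivity)]
    nlinarith
  have e1 : Real.exp T - 1 ≤ T * Real.exp T := by
    have := Real.add_one_le_exp (-T)
    have h3 : Real.exp (-T) * Real.exp T = 1 := by rw [← Real.exp_add]; simp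
    nlinarith [Real.exp_pos T]
  calc Real.exp (∑ k ∈ Finset.range N, ‖Ff a (z + k)⁻¹ - 1‖) - 1 ≤ Real.exp T - 1 := by gcongr
    _ ≤ T * Real.exp T := e1
    _ ≤ T * Real.exp 640 := by gcongr
    _ = 40 * Real.exp 640 / ‖z‖ ^ 2 := by rw [hT]; ring

/-- The complex extension of the remainder. -/
noncomputable def GG (α : ℝ) (z : ℂ) : ℂ :=
  -(AA α : ℂ) * (Complex.Gamma ((α / 2 : ℝ) + z) / Complex.Gamma (1 - (α / 2 : ℝ) + z)
    - z ^ ((α - 1 : ℝ) : ℂ))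

lemma GG_bound (α : ℝ) (h0 : 0 < α) (h1 : α < 2) (z : ℂ) (hz : 1 / 4 ≤ z.re) :
    ‖GG α z‖ ≤ |AA α| * (40 * Real.exp 640) * ‖z‖ ^ (α - 3) := by
  have hz0 : z ≠ 0 := by rintro rfl; norm_num at hz
  have hn : 0 < ‖z‖ := norm_pos_iff.2 hz0
  have e : GG α z = -(AA α : ℂ) * (z ^ ((α - 1 : ℝ) : ℂ) * (hh (α / 2) z - 1)) := by
    unfold GG hh
    have : z ^ ((1 - 2 * (α / 2) : ℝ) : ℂ) * z ^ ((α - 1 : ℝ) : ℂ) = 1 := by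
      rw [← Complex.cpow_add _ _ hz0]
      convert Complex.cpow_zero z using 2
      push_cast
      ring
    linear_combination (AA α : ℂ) * (Complex.Gamma ((α / 2 : ℝ) + z) /
      Complex.Gamma (1 - (α / 2 : ℝ) + z)) * this
  rw [e, norm_mul, norm_mul, norm_neg, Complex.norm_real, Complex.norm_cpow_real,
    Real.norm_eq_abs]
  have b := hh_bound (α / 2) (by linarith) (by linarith) z hz
  calc |AA α| * (‖z‖ ^ (α - 1) * ‖hh (α / 2) z - 1‖)
      ≤ |AA α| * (‖z‖ ^ (α - 1) * (40 * Real.exp 640 / ‖z‖ ^ 2)) := by gcongr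
    _ = |AA α| * (40 * Real.exp 640) * (‖z‖ ^ (α - 1) / ‖z‖ ^ 2) := by ring
    _ = _ := by
      rw [show α - 3 = (α - 1) - (2 : ℕ) by push_cast; ring, Real.rpow_sub_natCast hn.ne']

lemma isOpen_H : IsOpen {z : ℂ | 0 < z.re} := isOpen_lt continuous_const Complex.continuous_re

lemma GG_diff (α : ℝ) (h0 : 0 < α) (h1 : α < 2) :
    DifferentiableOn ℂ (GG α) {z : ℂ | 0 < z.re} := by
  intro z hz
  have hz : 0 < z.re := hz
  have hg : ∀ w : ℂ, 0 < w.re → DifferentiableAt ℂ Complex.Gamma w := by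
    intro w hw
    apply Complex.differentiableAt_Gamma
    intro m h
    have := congrArg Complex.re h
    simp at this
    have : (0:ℝ) ≤ m := by positivity
    linarith
  have p1 : 0 < (((α / 2 : ℝ) : ℂ) + z).re := by
    rw [Complex.add_re, Complex.ofReal_re]; linarith
  have p2 : 0 < (1 - ((α / 2 : ℝ) : ℂ) + z).re := by
    rw [Complex.add_re, Complex.sub_re, Complex.ofReal_re, Complex.one_re]; linarith
  have d1 : DifferentiableAt ℂ (fun z : ℂ => Complex.Gamma ((α / 2 : ℝ) + z)) z :=
    (hg _ p1).comp z (by fun_prop : DifferentiableAt ℂ (fun z : ℂ => ((α / 2 : ℝ) : ℂ) + z) z)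
  have d2 : DifferentiableAt ℂ (fun z : ℂ => Complex.Gamma (1 - (α / 2 : ℝ) + z)) z :=
    (hg _ p2).comp z (by fun_prop : DifferentiableAt ℂ (fun z : ℂ => 1 - ((α / 2 : ℝ) : ℂ) + z) z)
  have d3 : DifferentiableAt ℂ (fun z : ℂ => z ^ ((α - 1 : ℝ) : ℂ)) z :=
    differentiableAt_id.cpow_const (Or.inl hz)
  exact (((d1.div d2 (Complex.Gamma_ne_zero_of_re_pos p2)).sub d3).const_mul _).differentiableWithinAt

lemma GG_contDiffAt (α : ℝ) (h0 : 0 < α) (h1 : α < 2) (n : WithTop ℕ∞) (z : ℂ) (hz : 0 < z.re) :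
    ContDiffAt ℂ n (GG α) z :=
  ((GG_diff α h0 h1).contDiffOn isOpen_H).contDiffAt (isOpen_H.mem_nhds hz)

lemma mStar_eq (α : ℝ) (x : ℝ) (hx : 0 < x) : mStar α x = (GG α x).re := by
  have : GG α x = ((mStar α x : ℝ) : ℂ) := by
    unfold GG mStar LL
    rw [abs_of_pos hx, ← Complex.ofReal_cpow hx.le, ← Complex.ofReal_add, ← Complex.ofReal_one,
      ← Complex.ofReal_sub, ← Complex.ofReal_add, Complex.Gamma_ofReal, Complex.Gamma_ofReal]
    push_cast
    ring
  rw [this, Complex.ofReal_re]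

lemma iter_eq (α : ℝ) (h0 : 0 < α) (h1 : α < 2) (β : ℕ) : ∀ x : ℝ, 1 / 2 ≤ x →
    iteratedDerivWithin β (mStar α) (Set.Ici (1 / 2 : ℝ)) x = (iteratedDeriv β (GG α) x).re := by
  induction β with
  | zero =>
    intro x hx
    simp only [iteratedDerivWithin_zero, iteratedDeriv_zero]
    exact mStar_eq α x (by linarith)
  | succ n ih =>
    intro x hx
    rw [iteratedDerivWithin_succ, derivWithin_congr (s := Set.Ici (1 / 2 : ℝ)) (f := fun x : ℝ =>
      (iteratedDeriv n (GG α) x).re) (fun y hy => ih y hy) (ih x hx), iteratedDeriv_succ]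
    have hd : DifferentiableAt ℂ (iteratedDeriv n (GG α)) x := by
      rw [iteratedDeriv_eq_iterate]
      exact (((GG_diff α h0 h1).analyticAt
        (isOpen_H.mem_nhds (show 0 < ((x:ℂ)).re by simp; linarith))).iterated_deriv n).differentiableAt
    exact hd.hasDerivAt.real_of_complex.hasDerivWithinAt.derivWithin
      (uniqueDiffOn_Ici _ x hx)

/-- Asymptotic expansion of `L_α`: `m*(ξ) := L_α(ξ) - V_α + A_α ξ^(α-1)` is smooth on
`[1/2, ∞)` and is a Fourier multiplier of order `α - 3`, i.e. every derivative of
order `β` is bounded by `C_β ξ^(α-3-β)` there. -/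
theorem asymptotic_expansion_L (α : ℝ)
    (hα : α ∈ Set.Ioo (0 : ℝ) 1 ∪ Set.Ioo (1 : ℝ) 2) :
    ContDiffOn ℝ (⊤ : ℕ∞) (mStar α) (Set.Ici (1 / 2 : ℝ)) ∧
      ∀ β : ℕ, ∃ C : ℝ, 0 < C ∧
        ∀ ξ : ℝ, 1 / 2 ≤ ξ →
          |iteratedDerivWithin β (mStar α) (Set.Ici (1 / 2 : ℝ)) ξ| ≤
            C * ξ ^ (α - 3 - (β : ℝ)) := by
  have h0 : 0 < α := by
    rcases hα with h | h
    · exact h.1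
    · linarith [h.1]
  have h1 : α < 2 := by
    rcases hα with h | h
    · linarith [h.2]
    · exact h.2
  refine ⟨?_, fun β => ?_⟩
  · intro x hx
    have hx : 1 / 2 ≤ x := hx
    refine ContDiffAt.contDiffWithinAt ?_
    refine (GG_contDiffAt α h0 h1 _ x (by simp; linarith)).real_of_complex.congr_of_eventuallyEq ?_
    filter_upwards [lt_mem_nhds (show 0 < x by linarith)] with y hy
    exact mStar_eq α y hy
  · set K := |AA α| * (40 * Real.exp 640) with hK
    have hK0 : 0 ≤ K := by positivity
    set D := (β.factorial : ℝ) * (K * (1 / 2) ^ (α - 3)) * 2 ^ β with hD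
    have hD0 : 0 ≤ D := by positivity
    refine ⟨D + 1, by linarith, fun ξ hξ => ?_⟩
    have hξ0 : 0 < ξ := by linarith
    rw [iter_eq α h0 h1 β ξ hξ]
    refine (Complex.abs_re_le_norm _).trans ?_
    have hre : ∀ z : ℂ, dist z ξ ≤ ξ / 2 → ξ / 2 ≤ z.re := by
      intro z hz
      rw [dist_eq_norm] at hz
      have := (abs_le.1 ((Complex.abs_re_le_norm _).trans hz)).1
      simp at this
      linarith
    have hdc : DiffContOnCl ℂ (GG α) (Metric.ball (ξ:ℂ) (ξ / 2)) := by
      refine DifferentiableOn.diffContOnCl ((GG_diff α h0 h1).mono ?_)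
      intro z hz
      have := hre z (Metric.closure_ball_subset_closedBall hz)
      show 0 < z.re
      linarith
    have cauchy := Complex.norm_iteratedDeriv_le_of_forall_mem_sphere_norm_le (c := (ξ:ℂ))
      (R := ξ / 2) (C := K * (ξ / 2) ^ (α - 3)) (f := GG α) β (by linarith) hdc ?_
    · refine cauchy.trans ?_
      have e : (β.factorial : ℝ) * (K * (ξ / 2) ^ (α - 3)) / (ξ / 2) ^ β
          = D * ξ ^ (α - 3 - (β:ℝ)) := by
        rw [Real.rpow_sub_natCast hξ0.ne', hD, show ξ / 2 = ξ * (1 / 2) by ring,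
          Real.mul_rpow hξ0.le (by norm_num), mul_pow, one_div_pow]
        field_simp
      rw [e]
      have : 0 ≤ ξ ^ (α - 3 - (β:ℝ)) := by positivity
      nlinarith
    · intro z hz
      have hz2 := hre z (Metric.mem_sphere.1 hz).le
      refine (GG_bound α h0 h1 z (by linarith)).trans ?_
      refine mul_le_mul_of_nonneg_left ?_ hK0
      exact Real.rpow_le_rpow_of_nonpos (by linarith) (hz2.trans (Complex.re_le_norm _))
        (by linarith)
end

section
/- The dispersive part ω̇_α is a Fourier multiplier of order α: Let α ∈ (0,1). The function ξ ↦ ω̇_α(ξ) is infinitely differentiable on [1/2, ∞), and for every β ∈ ℕ there exists a constant C_β > 0 such that |d^β/dξ^β ω̇_α(ξ)| ≤ C_β · ξ^{α−β} for all ξ ≥ 1/2. -/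
/-- The dispersive part of the dispersion relation:
`ω̇_α(ξ) = -A_α ξ Γ(α/2+|ξ|)/Γ(1-α/2+|ξ|)`. -/
noncomputable def omegaDot (α ξ : ℝ) : ℝ :=
  -AA α * ξ * (Real.Gamma (α / 2 + |ξ|) / Real.Gamma (1 - α / 2 + |ξ|))

open MeasureTheory Set

/-- The Laplace density. -/
noncomputable def WW (α s : ℝ) : ℝ := Real.exp (-(α / 2 * s)) * (1 - Real.exp (-s)) ^ (-α)

/-- The measure whose moment generating function is the Gamma quotient. -/
noncomputable def MM (α : ℝ) : Measure ℝ :=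
  (volume.restrict (Ioi (0 : ℝ))).withDensity (fun s => ENNReal.ofReal (WW α s))

lemma WW_nonneg (α : ℝ) {s : ℝ} (hs : 0 < s) : 0 ≤ WW α s := by
  unfold WW
  have : 0 ≤ 1 - Real.exp (-s) := by
    have := Real.exp_le_one_iff.2 (by linarith : -s ≤ 0)
    linarith
  positivity

lemma WW_meas (α : ℝ) : Measurable (WW α) := by
  unfold WW
  fun_prop

lemma WW_le {α : ℝ} (hα : 0 < α) {s : ℝ} (hs : 0 < s) :
    WW α s ≤ s ^ (-α) * Real.exp (α / 2 * s) := by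
  unfold WW
  have h1 : s * Real.exp (-s) ≤ 1 - Real.exp (-s) := by
    have h := Real.add_one_le_exp s
    have h2 : Real.exp s * Real.exp (-s) = 1 := by rw [← Real.exp_add]; simp
    nlinarith [Real.exp_pos (-s)]
  have h2 : (1 - Real.exp (-s)) ^ (-α) ≤ (s * Real.exp (-s)) ^ (-α) :=
    Real.rpow_le_rpow_of_nonpos (by positivity) h1 (by linarith)
  have h3 : (s * Real.exp (-s)) ^ (-α) = s ^ (-α) * Real.exp (α * s) := by
    rw [Real.mul_rpow hs.le (Real.exp_pos _).le, ← Real.exp_mul]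
    congr 2; ring
  calc _ ≤ Real.exp (-(α / 2 * s)) * (s ^ (-α) * Real.exp (α * s)) := by
        rw [← h3]; gcongr
    _ = s ^ (-α) * (Real.exp (-(α / 2 * s)) * Real.exp (α * s)) := by ring
    _ = _ := by rw [← Real.exp_add]; congr 2; ring

lemma bound_fun {α : ℝ} (hα : 0 < α) (n : ℕ) (x : ℝ) {s : ℝ} (hs : 0 < s) :
    WW α s * (s ^ n * Real.exp (-(x * s))) ≤
      s ^ ((n + 1 - α) - 1) * Real.exp (-((x - α / 2) * s)) := by
  calc _ ≤ (s ^ (-α) * Real.exp (α / 2 * s)) * (s ^ n * Real.exp (-(x * s))) := by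
        gcongr; exact WW_le hα hs
    _ = (s ^ (-α) * s ^ n) * (Real.exp (α / 2 * s) * Real.exp (-(x * s))) := by ring
    _ = _ := by
        rw [← Real.exp_add, ← Real.rpow_natCast, ← Real.rpow_add hs]
        congr 2 <;> ring

lemma integ_bd {α : ℝ} (hα1 : α < 1) (n : ℕ) {x : ℝ} (hx : α / 2 < x) :
    IntegrableOn (fun s => s ^ (((n : ℝ) + 1 - α) - 1) * Real.exp (-((x - α / 2) * s)))
      (Ioi 0) := by
  have := integrableOn_rpow_mul_exp_neg_mul_rpow (p := 1) (s := ((n : ℝ) + 1 - α) - 1)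
    (b := x - α / 2) (by have : (0 : ℝ) ≤ n := n.cast_nonneg
                         linarith) one_pos (by linarith)
  refine this.congr_fun (fun s hs => ?_) measurableSet_Ioi
  simp only [Real.rpow_one, neg_mul]

lemma integ_W {α : ℝ} (hα : 0 < α) (hα1 : α < 1) (n : ℕ) {x : ℝ} (hx : α / 2 < x) :
    IntegrableOn (fun s => WW α s * (s ^ n * Real.exp (-(x * s)))) (Ioi 0) := by
  refine Integrable.mono' (integ_bd hα1 n hx) ?_ ?_
  · have := WW_meas α
    exact Measurable.aestronglyMeasurable (by fun_prop)
  · filter_upwards [ae_restrict_mem measurableSet_Ioi] with s hs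
    have hs' : 0 < s := hs
    have := WW_nonneg α hs'
    rw [Real.norm_of_nonneg (by positivity)]
    exact bound_fun hα n x hs'

lemma integral_bd {α : ℝ} (hα : 0 < α) (hα1 : α < 1) (n : ℕ) {x : ℝ} (hx : α / 2 < x) :
    ∫ s in Ioi 0, WW α s * (s ^ n * Real.exp (-(x * s))) ≤
      (1 / (x - α / 2)) ^ ((n : ℝ) + 1 - α) * Real.Gamma ((n : ℝ) + 1 - α) := by
  rw [← Real.integral_rpow_mul_exp_neg_mul_Ioi
    (by have : (0 : ℝ) ≤ n := n.cast_nonneg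
        linarith) (by linarith)]
  exact setIntegral_mono_on (integ_W hα hα1 n hx) (integ_bd hα1 n hx) measurableSet_Ioi
    (fun s hs => bound_fun hα n x hs)

lemma integral_MM (α : ℝ) (g : ℝ → ℝ) :
    ∫ s, g s ∂(MM α) = ∫ s in Ioi 0, WW α s * g s := by
  unfold MM
  rw [integral_withDensity_eq_integral_toReal_smul (WW_meas α).ennreal_ofReal (by simp)]
  refine setIntegral_congr_fun measurableSet_Ioi (fun s hs => ?_)
  simp [ENNReal.toReal_ofReal (WW_nonneg α hs)]

lemma integrable_MM (α : ℝ) (g : ℝ → ℝ) (h : IntegrableOn (fun s => WW α s * g s) (Ioi 0)) :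
    Integrable g (MM α) := by
  unfold MM
  rw [integrable_withDensity_iff_integrable_smul' (WW_meas α).ennreal_ofReal (by simp)]
  refine IntegrableOn.congr_fun h (fun s hs => ?_) measurableSet_Ioi
  simp [ENNReal.toReal_ofReal (WW_nonneg α hs)]

lemma mem_int {α : ℝ} (hα : 0 < α) (hα1 : α < 1) {x : ℝ} (hx : α / 2 < x) :
    x ∈ interior (ProbabilityTheory.integrableExpSet (fun s : ℝ => -s) (MM α)) := by
  have : Ioi (α / 2) ⊆ ProbabilityTheory.integrableExpSet (fun s : ℝ => -s) (MM α) := by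
    intro y hy
    refine integrable_MM α _ ?_
    simpa using integ_W hα hα1 0 hy
  exact interior_maximal this isOpen_Ioi hx

/-- The derivatives. -/
noncomputable def FF (α : ℝ) (n : ℕ) (x : ℝ) : ℝ :=
  ∫ s, (-s) ^ n * Real.exp (x * (-s)) ∂(MM α)

lemma FF_deriv {α : ℝ} (hα : 0 < α) (hα1 : α < 1) (n : ℕ) {x : ℝ} (hx : α / 2 < x) :
    HasDerivAt (FF α n) (FF α (n + 1) x) x :=
  ProbabilityTheory.hasDerivAt_integral_pow_mul_exp_real (mem_int hα hα1 hx) n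

lemma FF_bd {α : ℝ} (hα : 0 < α) (hα1 : α < 1) (n : ℕ) : ∃ C : ℝ, 0 < C ∧
    ∀ x : ℝ, 1 / 2 ≤ x → |FF α n x| ≤ C * x ^ (α - 1 - n) := by
  have hn : (0 : ℝ) ≤ n := n.cast_nonneg
  have hG : 0 < Real.Gamma ((n : ℝ) + 1 - α) := Real.Gamma_pos_of_pos (by linarith)
  have h1 : 0 < 1 - α := by linarith
  refine ⟨(1 / (1 - α)) ^ ((n : ℝ) + 1 - α) * Real.Gamma ((n : ℝ) + 1 - α), by positivity, ?_⟩
  intro x hx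
  have hx0 : 0 < x := by linarith
  have hle : |FF α n x| ≤ ∫ s in Ioi 0, WW α s * (s ^ n * Real.exp (-(x * s))) := by
    unfold FF
    rw [integral_MM, ← Real.norm_eq_abs]
    refine (norm_integral_le_integral_norm _).trans (le_of_eq ?_)
    refine setIntegral_congr_fun measurableSet_Ioi (fun s hs => ?_)
    have hs' : 0 < s := hs
    simp [abs_of_nonneg (WW_nonneg α hs'), abs_of_pos hs']
  refine hle.trans ((integral_bd hα hα1 n (by linarith)).trans ?_)
  have h2 : (1 / (x - α / 2)) ^ ((n : ℝ) + 1 - α) ≤ (1 / ((1 - α) * x)) ^ ((n : ℝ) + 1 - α) := by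
    refine Real.rpow_le_rpow ?_ ?_ (by linarith)
    · have : 0 < x - α / 2 := by linarith
      positivity
    · exact one_div_le_one_div_of_le (by positivity) (by nlinarith)
  have h3 : (1 / ((1 - α) * x)) ^ ((n : ℝ) + 1 - α) =
      (1 / (1 - α)) ^ ((n : ℝ) + 1 - α) * x ^ (α - 1 - n) := by
    rw [← one_div_mul_one_div, Real.mul_rpow (by positivity) (by positivity)]
    congr 1
    rw [one_div, Real.inv_rpow hx0.le, ← Real.rpow_neg hx0.le]
    congr 1; ring
  calc _ ≤ (1 / ((1 - α) * x)) ^ ((n : ℝ) + 1 - α) * Real.Gamma ((n : ℝ) + 1 - α) := by gcongr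
    _ = _ := by rw [h3]; ring

lemma beta_real {u v : ℝ} (hu : 0 < u) (hv : 0 < v) :
    Real.Gamma u * Real.Gamma v / Real.Gamma (u + v) =
      ∫ t in Ioo (0 : ℝ) 1, t ^ (u - 1) * (1 - t) ^ (v - 1) := by
  have h := ProbabilityTheory.beta_eq_betaIntegralReal u v hu hv
  unfold ProbabilityTheory.beta at h
  have h2 : Complex.betaIntegral u v =
      ((∫ t in Ioo (0 : ℝ) 1, t ^ (u - 1) * (1 - t) ^ (v - 1) : ℝ) : ℂ) := by
    rw [Complex.betaIntegral, intervalIntegral.integral_of_le zero_le_one,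
      integral_Ioc_eq_integral_Ioo, ← integral_complex_ofReal]
    refine setIntegral_congr_fun measurableSet_Ioo (fun t ht => ?_)
    rw [Complex.ofReal_mul, Complex.ofReal_cpow ht.1.le,
      Complex.ofReal_cpow (by linarith [ht.2])]
    push_cast
    rfl
  rw [h, h2, Complex.ofReal_re]

lemma FF_zero {α : ℝ} (hα : 0 < α) (hα1 : α < 1) {x : ℝ} (hx : α / 2 < x) :
    FF α 0 x = Real.Gamma (α / 2 + x) * Real.Gamma (1 - α) / Real.Gamma (1 - α / 2 + x) := by
  have e : 1 - α / 2 + x = (α / 2 + x) + (1 - α) := by ring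
  rw [e, beta_real (by linarith) (by linarith)]
  have himg : (fun s : ℝ => Real.exp (-s)) '' Ioi 0 = Ioo 0 1 := by
    ext t
    constructor
    · rintro ⟨s, hs, rfl⟩
      exact ⟨Real.exp_pos _, by simpa using hs⟩
    · rintro ⟨h0, h1⟩
      exact ⟨-Real.log t, by simpa using Real.log_neg h0 h1, by simp [Real.exp_log h0]⟩
  rw [← himg, integral_image_eq_integral_abs_deriv_smul (f' := fun s => -Real.exp (-s))
    measurableSet_Ioi]
  · unfold FF
    rw [integral_MM]
    refine setIntegral_congr_fun measurableSet_Ioi (fun s hs => ?_)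
    simp only [WW, smul_eq_mul, abs_neg, abs_of_pos (Real.exp_pos _), pow_zero, one_mul]
    rw [← Real.exp_mul, ← mul_assoc, ← Real.exp_add, mul_right_comm, ← Real.exp_add]
    congr 2 <;> ring
  · intro s hs
    have := ((hasDerivAt_id s).neg).exp
    simpa using this.hasDerivWithinAt
  · intro s _ t _ h
    simpa using h

lemma omega_eq {α : ℝ} (hα : 0 < α) (hα1 : α < 1) {x : ℝ} (hx : x ∈ Ici (1 / 2 : ℝ)) :
    omegaDot α x = (-AA α / Real.Gamma (1 - α)) * (x * FF α 0 x) := by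
  have hx' : 1 / 2 ≤ x := hx
  have hG : Real.Gamma (1 - α) ≠ 0 := (Real.Gamma_pos_of_pos (by linarith)).ne'
  rw [FF_zero hα hα1 (by linarith), omegaDot, abs_of_nonneg (by linarith)]
  field_simp

lemma iter_omega {α : ℝ} (hα : 0 < α) (hα1 : α < 1) (β : ℕ) :
    ∀ x ∈ Ici (1 / 2 : ℝ), iteratedDerivWithin β (omegaDot α) (Ici (1 / 2 : ℝ)) x =
      (-AA α / Real.Gamma (1 - α)) * (x * FF α β x + β * FF α (β - 1) x) := by
  induction β with
  | zero => intro x hx; simp [omega_eq hα hα1 hx]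
  | succ n ih =>
    intro x hx
    have hx' : 1 / 2 ≤ x := hx
    rw [iteratedDerivWithin_succ, derivWithin_congr ih (ih x hx)]
    refine HasDerivWithinAt.derivWithin ?_ (uniqueDiffOn_Ici _ x hx)
    refine HasDerivAt.hasDerivWithinAt ?_
    have hd := fun k => FF_deriv hα hα1 k (x := x) (by linarith)
    cases n with
    | zero =>
      have h := (((hasDerivAt_id' x).fun_mul (hd 0)).const_mul (-AA α / Real.Gamma (1 - α)))
      simp only [Nat.cast_zero, zero_mul, add_zero]
      refine h.congr_deriv ?_
      push_cast
      ring
    | succ m =>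
      have h := ((((hasDerivAt_id' x).fun_mul (hd (m + 1))).fun_add
        ((hd m).const_mul ((m + 1 : ℕ) : ℝ))).const_mul (-AA α / Real.Gamma (1 - α)))
      refine h.congr_deriv ?_
      push_cast
      ring

/-- The dispersive part `ω̇_α` is a Fourier multiplier of order `α` for `α ∈ (0,1)`:
it is smooth on `[1/2, ∞)` and every derivative of order `β` is bounded by
`C_β ξ^(α-β)` there. -/
theorem omegaDot_is_multiplier_of_order_alpha (α : ℝ) (hα : α ∈ Set.Ioo (0 : ℝ) 1) :
    ContDiffOn ℝ (⊤ : ℕ∞) (omegaDot α) (Set.Ici (1 / 2 : ℝ)) ∧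
      ∀ β : ℕ, ∃ C : ℝ, 0 < C ∧
        ∀ ξ : ℝ, 1 / 2 ≤ ξ →
          |iteratedDerivWithin β (omegaDot α) (Set.Ici (1 / 2 : ℝ)) ξ| ≤
            C * ξ ^ (α - (β : ℝ)) := by
  obtain ⟨h0, h1⟩ := hα
  constructor
  · have hF : ContDiffOn ℝ (⊤ : ℕ∞) (FF α 0) (Ici (1 / 2 : ℝ)) := by
      intro x hx
      have hx' : 1 / 2 ≤ x := hx
      have := (ProbabilityTheory.analyticAt_mgf (mem_int h0 h1 (x := x) (by linarith)))
      have e : ProbabilityTheory.mgf (fun s : ℝ => -s) (MM α) = FF α 0 := by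
        ext y; simp [ProbabilityTheory.mgf, FF]
      rw [e] at this
      exact this.contDiffAt.contDiffWithinAt
    exact (contDiffOn_const.mul (contDiffOn_id.mul hF)).congr (fun x hx => omega_eq h0 h1 hx)
  · intro β
    obtain ⟨C, hC, hCb⟩ := FF_bd h0 h1 β
    obtain ⟨D, hD, hDb⟩ := FF_bd h0 h1 (β - 1)
    refine ⟨|-AA α / Real.Gamma (1 - α)| * (C + β * D) + 1, by positivity, ?_⟩
    intro x hx
    have hx0 : 0 < x := by linarith
    rw [iter_omega h0 h1 β x hx, abs_mul]
    have hp : 0 < x ^ (α - (β : ℝ)) := by positivity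
    have b1 : |x * FF α β x| ≤ C * x ^ (α - (β : ℝ)) := by
      rw [abs_mul, abs_of_pos hx0]
      calc _ ≤ x * (C * x ^ (α - 1 - β)) := by gcongr; exact hCb x hx
        _ = C * (x ^ (1 : ℝ) * x ^ (α - 1 - β)) := by rw [Real.rpow_one]; ring
        _ = _ := by rw [← Real.rpow_add hx0]; congr 2; ring
    have b2 : |β * FF α (β - 1) x| ≤ β * D * x ^ (α - (β : ℝ)) := by
      cases β with
      | zero => simp
      | succ m =>
        rw [abs_mul, Nat.abs_cast, mul_assoc]
        have e : α - ((m + 1 : ℕ) : ℝ) = α - 1 - ((m + 1 - 1 : ℕ) : ℝ) := by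
          rw [Nat.add_sub_cancel]; push_cast; ring
        rw [e]
        exact mul_le_mul_of_nonneg_left (hDb x hx) (Nat.cast_nonneg _)
    calc _ ≤ |-AA α / Real.Gamma (1 - α)| *
          (C * x ^ (α - (β : ℝ)) + β * D * x ^ (α - (β : ℝ))) := by
          gcongr
          exact (abs_add_le _ _).trans (add_le_add b1 b2)
      _ ≤ _ := by linarith
end
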